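/- Let p = p_n be a sequence of positive integers with n > p_n for all n, and set r_n = (−log(1 − p/n))^{1/2}. Assume p/n → y ∈ (0, 1] as n → ∞, and let t = t_n be a real sequence with t_n = O(1/r_n) as n → ∞. Then log[ (Γ(n/2 + t)/Γ(n/2)) · (Γ((n−p)/2)/Γ((n−p)/2 + t)) ] = r_n²·t + o(1) as n → ∞. -/

import Mathlib

open Filter Topology Asymptotics

lemma aux_feq {x : ℝ} (hx : 0 < x) :
    Real.log (Real.Gamma (x + 1)) = Real.log (Real.Gamma x) + Real.log x := by
  rw [Real.Gamma_add_one hx.ne', Real.log_mul hx.ne' (Real.Gamma_pos_of_pos hx).ne', add_comm]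

lemma aux_nat {x : ℝ} (hx : 0 < x) (k : ℕ) :
    k * Real.log x ≤ Real.log (Real.Gamma (x + k)) - Real.log (Real.Gamma x) ∧
    Real.log (Real.Gamma (x + k)) - Real.log (Real.Gamma x) ≤ k * Real.log (x + k) := by
  induction k with
  | zero => simp
  | succ k ih =>
    have hk : (0:ℝ) ≤ k := Nat.cast_nonneg k
    have h1 := aux_feq (x := x + k) (by linarith)
    have h2 : Real.log x ≤ Real.log (x + k) := Real.log_le_log hx (by linarith)
    have h3 : Real.log (x + k) ≤ Real.log (x + k + 1) :=
      Real.log_le_log (by linarith) (by linarith)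
    have h4 : (k:ℝ) * Real.log (x + k) ≤ k * Real.log (x + k + 1) :=
      mul_le_mul_of_nonneg_left h3 hk
    push_cast
    rw [← add_assoc, h1]
    constructor <;> linarith [ih.1, ih.2]

lemma aux_logdiff {a b : ℝ} (ha : 0 < a) (hb : 0 < b) :
    Real.log b - Real.log a ≤ (b - a) / a := by
  have := Real.log_le_sub_one_of_pos (div_pos hb ha)
  rw [Real.log_div hb.ne' ha.ne'] at this
  rw [sub_div, div_self ha.ne']
  exact this

lemma aux_A0 {x t : ℝ} {k : ℕ} (hk : 0 < k) (hx : (k:ℝ) < x) (ht : |t| ≤ k) :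
    |Real.log (Real.Gamma (x + t)) - Real.log (Real.Gamma x) - t * Real.log x|
      ≤ |t| * (k / (x - k)) := by
  have hk' : (0:ℝ) < k := Nat.cast_pos.mpr hk
  rcases eq_or_ne t 0 with rfl | h0
  · simp
  obtain ⟨hl, hu⟩ := abs_le.mp ht
  have hc := Real.convexOn_log_Gamma
  have m0 : x ∈ Set.Ioi (0:ℝ) := by simp; linarith
  have m1 : x - k ∈ Set.Ioi (0:ℝ) := by simp; linarith
  have m2 : x + k ∈ Set.Ioi (0:ℝ) := by simp; linarith
  have m3 : x + t ∈ Set.Ioi (0:ℝ) := by simp; linarith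
  have s1 := hc.secant_mono m0 m1 m3 (by linarith) (by simpa using h0) (by linarith)
  have s2 := hc.secant_mono m0 m3 m2 (by simpa using h0) (by linarith) (by linarith)
  simp only [Function.comp, add_sub_cancel_left] at s1 s2
  have n1 := (aux_nat m1 k).1
  have n2 := (aux_nat m0 k).2
  rw [sub_add_cancel] at n1
  set S := (Real.log (Real.Gamma (x + t)) - Real.log (Real.Gamma x)) / t with hS
  have e1 : Real.log (x - k) ≤ S := by
    refine le_trans ?_ s1
    rw [show x - k - x = -(k:ℝ) by ring, le_div_iff_of_neg (by linarith)]
    linarith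
  have e2 : S ≤ Real.log (x + k) := by
    refine le_trans s2 ?_
    rw [div_le_iff₀ hk']
    linarith
  have d1 := aux_logdiff m1 m0
  have d2 := aux_logdiff m0 m2
  rw [show x - (x - k) = (k:ℝ) by ring] at d1
  rw [add_sub_cancel_left] at d2
  have d3 : (k:ℝ) / x ≤ k / (x - k) :=
    div_le_div_of_nonneg_left hk'.le m1 (by linarith)
  have e3 : Real.log (Real.Gamma (x + t)) - Real.log (Real.Gamma x) - t * Real.log x
      = t * (S - Real.log x) := by
    rw [hS]; field_simp
  rw [e3, abs_mul]
  apply mul_le_mul_of_nonneg_left _ (abs_nonneg t)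
  rw [abs_le]
  constructor <;> linarith

lemma aux_B {x t : ℝ} (hx : 1 / 2 ≤ x) (ht : |t| ≤ 1 / 4) :
    |Real.log (Real.Gamma (x + t)) - Real.log (Real.Gamma x) - t * Real.log x|
      ≤ 8 * |t| := by
  obtain ⟨hl, hu⟩ := abs_le.mp ht
  have h1 := aux_A0 (x := x + 1) (t := t) (k := 1) one_pos (by push_cast; linarith)
    (by push_cast; linarith)
  have f1 := aux_feq (x := x) (by linarith)
  have f2 := aux_feq (x := x + t) (by linarith)
  rw [show x + 1 + t = x + t + 1 by ring, f1, f2] at h1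
  push_cast at h1
  rw [add_sub_cancel_right] at h1
  have i1 : 1 / x ≤ 2 := by rw [div_le_iff₀ (by linarith)]; linarith
  have h2 : |Real.log (x + t) - Real.log x| ≤ 4 * |t| := by
    have a1 := aux_logdiff (a := x) (b := x + t) (by linarith) (by linarith)
    have a2 := aux_logdiff (a := x + t) (b := x) (by linarith) (by linarith)
    have b1 : (x + t - x) / x ≤ 4 * |t| := by
      rw [div_le_iff₀ (by linarith)]
      nlinarith [le_abs_self t, abs_nonneg t]
    have b2 : (x - (x + t)) / (x + t) ≤ 4 * |t| := by
      rw [div_le_iff₀ (by linarith)]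
      nlinarith [neg_abs_le t, abs_nonneg t]
    rw [abs_le]; constructor <;> linarith
  have h3 : |t * (Real.log (x + 1) - Real.log x)| ≤ 2 * |t| := by
    have a1 := aux_logdiff (a := x) (b := x + 1) (by linarith) (by linarith)
    rw [add_sub_cancel_left] at a1
    have a2 : Real.log x ≤ Real.log (x + 1) := Real.log_le_log (by linarith) (by linarith)
    rw [abs_mul, abs_of_nonneg (by linarith : 0 ≤ Real.log (x + 1) - Real.log x)]
    nlinarith [abs_nonneg t]
  have h4 : |t| * (1 / x) ≤ 2 * |t| := by nlinarith [abs_nonneg t]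
  have h1' := abs_le.mp (h1.trans h4)
  have h2' := abs_le.mp h2
  have h3' := abs_le.mp h3
  rw [abs_le]
  constructor <;> linarith [h1'.1, h1'.2, h2'.1, h2'.2, h3'.1, h3'.2]

lemma aux_A {u t : ℕ → ℝ} (hu : Tendsto u atTop atTop) {C : ℝ}
    (ht : ∀ᶠ n in atTop, |t n| ≤ C) :
    Tendsto (fun n => Real.log (Real.Gamma (u n + t n)) - Real.log (Real.Gamma (u n))
      - t n * Real.log (u n)) atTop (𝓝 0) := by
  obtain ⟨k, hk⟩ := exists_nat_gt (max C 0)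
  have hk0 : 0 < k := by
    have : (0:ℝ) < k := lt_of_le_of_lt (le_max_right _ _) hk
    exact_mod_cast this
  have hlim : Tendsto (fun n => (k:ℝ) * (k / (u n - k))) atTop (𝓝 0) := by
    have : Tendsto (fun n => u n - k) atTop atTop := tendsto_atTop_add_const_right _ _ hu
    simpa using (this.const_div_atTop (k:ℝ)).const_mul (k:ℝ)
  apply squeeze_zero_norm' _ hlim
  filter_upwards [ht, hu.eventually_gt_atTop (k:ℝ)] with n h1 h2
  have h3 : |t n| ≤ k := h1.trans ((le_max_left _ _).trans hk.le)
  rw [Real.norm_eq_abs]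
  refine (aux_A0 hk0 h2 h3).trans ?_
  apply mul_le_mul_of_nonneg_right h3
  apply div_nonneg (Nat.cast_nonneg k); linarith

/-- Jiang–Yang, Lemma 5.3: with `p = p_n < n`, `r_n = (−log(1 − p/n))^{1/2}`,
`p/n → y ∈ (0,1]` and `t = t_n = O(1/r_n)`, one has
`log[ (Γ(n/2 + t)/Γ(n/2)) · (Γ((n−p)/2)/Γ((n−p)/2 + t)) ] = r_n²·t + o(1)`. -/
theorem stmt_4 (p : ℕ → ℕ) (hp : ∀ n, 0 < p n) (hpn : ∀ n, 2 ≤ n → p n < n)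
    (y : ℝ) (hy : y ∈ Set.Ioc (0 : ℝ) 1)
    (hlim : Tendsto (fun n : ℕ => (p n : ℝ) / n) atTop (𝓝 y))
    (r : ℕ → ℝ) (hr : ∀ n, r n = Real.sqrt (-Real.log (1 - (p n : ℝ) / n)))
    (t : ℕ → ℝ) (ht : t =O[atTop] fun n => (r n)⁻¹) :
    Tendsto (fun n : ℕ =>
        Real.log ((Real.Gamma ((n : ℝ) / 2 + t n) / Real.Gamma ((n : ℝ) / 2))
            * (Real.Gamma (((n : ℝ) - p n) / 2) / Real.Gamma (((n : ℝ) - p n) / 2 + t n)))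
          - (r n) ^ 2 * t n)
      atTop (𝓝 0) := by
  have hn2 : Tendsto (fun n : ℕ => (n:ℝ) / 2) atTop atTop :=
    tendsto_natCast_atTop_atTop.atTop_div_const (by norm_num)
  have h1y : Tendsto (fun n : ℕ => 1 - (p n : ℝ) / n) atTop (𝓝 (1 - y)) := hlim.const_sub 1
  have hm : ∀ n : ℕ, 2 ≤ n → (1:ℝ) / 2 ≤ ((n:ℝ) - p n) / 2 := by
    intro n hn
    have : ((p n + 1 : ℕ) : ℝ) ≤ n := by exact_mod_cast hpn n hn
    push_cast at this
    linarith
  -- the key facts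
  have key : (∃ C, ∀ᶠ n in atTop, |t n| ≤ C) ∧
      (∀ᶠ n : ℕ in atTop, 0 < ((n:ℝ) - p n) / 2 + t n) ∧
      Tendsto (fun n : ℕ => Real.log (Real.Gamma (((n:ℝ) - p n) / 2 + t n))
        - Real.log (Real.Gamma (((n:ℝ) - p n) / 2))
        - t n * Real.log (((n:ℝ) - p n) / 2)) atTop (𝓝 0) := by
    rcases hy.2.lt_or_eq with hlt | heq
    · have hrl : Tendsto r atTop (𝓝 (Real.sqrt (-Real.log (1 - y)))) := by
        rw [show r = _ from funext hr]
        exact ((h1y.log (by linarith)).neg).sqrt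
      have hpos : 0 < Real.sqrt (-Real.log (1 - y)) := by
        apply Real.sqrt_pos.mpr
        have := Real.log_neg (x := 1 - y) (by linarith) (by linarith [hy.1])
        linarith
      have hO : t =O[atTop] (fun _ => (1:ℝ)) := ht.trans ((hrl.inv₀ hpos.ne').isBigO_one ℝ)
      obtain ⟨C, hC⟩ := hO.bound
      have hC' : ∀ᶠ n in atTop, |t n| ≤ C := by simpa using hC
      have hmt : Tendsto (fun n : ℕ => ((n:ℝ) - p n) / 2) atTop atTop := by
        have := hn2.atTop_mul_pos (by linarith : 0 < 1 - y) h1y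
        refine this.congr' ?_
        filter_upwards [eventually_ge_atTop 1] with n hn
        have : (n:ℝ) ≠ 0 := by positivity
        field_simp
      refine ⟨⟨C, hC'⟩, ?_, aux_A hmt hC'⟩
      filter_upwards [hC', hmt.eventually_gt_atTop C] with n a b
      linarith [neg_abs_le (t n)]
    · have hrl : Tendsto r atTop atTop := by
        rw [show r = _ from funext hr]
        apply Real.tendsto_sqrt_atTop.comp
        apply tendsto_neg_atBot_atTop.comp
        apply Real.tendsto_log_nhdsGT_zero.comp
        rw [heq, sub_self] at h1y
        apply tendsto_nhdsWithin_of_tendsto_nhds_of_eventually_within _ h1y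
        filter_upwards [eventually_ge_atTop 2] with n hn
        have h0 : (0:ℝ) < n := by positivity
        have : (p n : ℝ) < n := by exact_mod_cast hpn n hn
        have := (div_lt_one h0).mpr this
        simp only [Set.mem_Ioi]; linarith
      have ht0 : Tendsto t atTop (𝓝 0) := ht.trans_tendsto (tendsto_inv_atTop_zero.comp hrl)
      have hta : Tendsto (fun n => |t n|) atTop (𝓝 0) := by simpa using ht0.abs
      have hC' : ∀ᶠ n in atTop, |t n| ≤ 1 / 4 :=
        hta.eventually_le_const (by norm_num)
      refine ⟨⟨_, hC'⟩, ?_, ?_⟩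
      · filter_upwards [hC', eventually_ge_atTop 2] with n a b
        linarith [neg_abs_le (t n), hm n b]
      · have : Tendsto (fun n => 8 * |t n|) atTop (𝓝 0) := by simpa using hta.const_mul 8
        apply squeeze_zero_norm' _ this
        filter_upwards [hC', eventually_ge_atTop 2] with n a b
        exact aux_B (hm n b) a
  obtain ⟨⟨C, hC⟩, hpos, hB⟩ := key
  have hA := aux_A hn2 hC
  have := hA.sub hB
  rw [sub_zero] at this
  refine this.congr' ?_
  filter_upwards [hC, hpos, hn2.eventually_gt_atTop C, eventually_ge_atTop 2] with n a b c d
  have hmn := hm n d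
  have hn0 : (0:ℝ) < n := by positivity
  have p1 := Real.Gamma_pos_of_pos (s := (n:ℝ) / 2 + t n) (by linarith [neg_abs_le (t n)])
  have p2 := Real.Gamma_pos_of_pos (s := (n:ℝ) / 2) (by linarith)
  have p3 := Real.Gamma_pos_of_pos (s := ((n:ℝ) - p n) / 2) (by linarith)
  have p4 := Real.Gamma_pos_of_pos b
  have hle : 0 ≤ (p n : ℝ) / n := by positivity
  have e1 : 1 - (p n : ℝ) / n = (((n:ℝ) - p n) / 2) / (n / 2) := by field_simp
  have e2 : (r n) ^ 2 = Real.log (n / 2) - Real.log (((n:ℝ) - p n) / 2) := by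
    rw [hr, Real.sq_sqrt, e1, Real.log_div (by linarith) (by linarith)]
    · ring
    · have h5 : 0 ≤ 1 - (p n : ℝ) / n := by
        rw [e1]; apply div_nonneg <;> linarith
      have := Real.log_nonpos h5 (by linarith)
      linarith
  rw [e2, Real.log_mul (div_pos p1 p2).ne' (div_pos p3 p4).ne', Real.log_div p1.ne' p2.ne',
    Real.log_div p3.ne' p4.ne']
  ring
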